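/- Let G be a finite group. For each conjugacy class C of G fix a representative r_C ∈ C, a transversal p_C : C → G with p_C(c)·r_C·p_C(c)⁻¹ = c, and a complete set Irr(Z(r_C)) of pairwise non-isomorphic irreducible unitary representations of the centralizer Z(r_C). Then in the ribbon algebra of G, Σ over conjugacy classes C and over R ∈ Irr(Z(r_C)) of (|C|·d_R)·M^{[C,R]} equals |G|·Σ_{g∈G} F^{e,g}; equivalently, (1/|G|)·Σ_{C,R} (|C|·d_R/|G|)·M^{[C,R]} = Ω. -/

import Mathlib

/-!
Statement 9: The weighted sum of the trace anyon-creating operators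
`M^{[C,R]} := Σ_{c∈C} Σ_{z∈Z(r)} χ^R(z)·F^{p(c)·z·p(c)⁻¹, c}`
over all conjugacy classes `C` and all irreducible unitary representations `R` of `Z(r_C)`
with weights `|C|·d_R` equals `|G|·Σ_{g∈G} F^{e,g}`; equivalently,
`(1/|G|)·Σ_{C,R} (|C|·d_R/|G|)·M^{[C,R]} = Ω`.
-/

open scoped Classical

noncomputable section

/-- `F^{g,h}`: the indicator function of the pair `(g,h)`. -/
def Fgh {G : Type*} (g h : G) : G × G → ℂ := fun x => if x = (g, h) then 1 else 0

/-- The Ω-strand `Ω := (1/|G|)·Σ_{g∈G} F^{e,g}`. -/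
def Omega (G : Type*) [Group G] [Fintype G] : G × G → ℂ :=
  (Fintype.card G : ℂ)⁻¹ • ∑ g : G, Fgh (1 : G) g

/-- The conjugacy class of `r` in `G`, as a `Finset`. -/
def conjClass {G : Type*} [Group G] [Fintype G] (r : G) : Finset G :=
  Finset.image (fun g => g * r * g⁻¹) Finset.univ

/-- The centralizer `Z(r)` of `r` in `G`, as a `Finset`. -/
def centFinset {G : Type*} [Group G] [Fintype G] (r : G) : Finset G :=
  Finset.univ.filter fun z => z * r = r * z

/-- `ρ : G → Matrix (Fin d) (Fin d) ℂ` restricts to a unitary representation of `Z(r)`. -/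
def IsCentRep {G : Type*} [Group G] [Fintype G] (r : G) {d : ℕ}
    (ρ : G → Matrix (Fin d) (Fin d) ℂ) : Prop :=
  ρ 1 = 1 ∧
  (∀ z w : G, z * r = r * z → w * r = r * w → ρ (z * w) = ρ z * ρ w) ∧
  (∀ z : G, z * r = r * z → ρ z ∈ Matrix.unitaryGroup (Fin d) ℂ)

/-- `ρ` restricts to an irreducible unitary representation of `Z(r)`. -/
def IsCentIrrep {G : Type*} [Group G] [Fintype G] (r : G) {d : ℕ}
    (ρ : G → Matrix (Fin d) (Fin d) ℂ) : Prop :=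
  IsCentRep r ρ ∧
  ∀ M : Matrix (Fin d) (Fin d) ℂ,
    (∀ z : G, z * r = r * z → M * ρ z = ρ z * M) →
    ∃ c : ℂ, M = c • (1 : Matrix (Fin d) (Fin d) ℂ)

/-- Isomorphism of two representations of the centralizer `Z(r)`. -/
def RepIsoOn {G : Type*} [Group G] [Fintype G] (r : G) {d₁ d₂ : ℕ}
    (ρ₁ : G → Matrix (Fin d₁) (Fin d₁) ℂ) (ρ₂ : G → Matrix (Fin d₂) (Fin d₂) ℂ) : Prop :=
  ∃ (U : Matrix (Fin d₁) (Fin d₂) ℂ) (V : Matrix (Fin d₂) (Fin d₁) ℂ),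
    U * V = 1 ∧ V * U = 1 ∧ ∀ z : G, z * r = r * z → ρ₁ z * U = U * ρ₂ z

/-- The trace anyon-creating operator
`M^{[C,R]} := Σ_{c∈C} Σ_{z∈Z(r)} χ^R(z)·F^{p(c)·z·p(c)⁻¹, c}`. -/
def Mtr {G : Type*} [Group G] [Fintype G] (r : G) (p : G → G) {d : ℕ}
    (ρ : G → Matrix (Fin d) (Fin d) ℂ) : G × G → ℂ :=
  ∑ c ∈ conjClass r, ∑ z ∈ centFinset r, (ρ z).trace • Fgh (p c * z * (p c)⁻¹) c

universe u

section UnitaryMatrixRep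
open Matrix
open scoped ComplexOrder

variable {H n m : Type*} [Group H] [Fintype n] [DecidableEq n] [Fintype m] [DecidableEq m]

/-- The commutant of a matrix representation consists of scalars; for unitary representations this
is irreducibility. -/
def HasScalarCommutant (φ : H →* Matrix n n ℂ) : Prop :=
  ∀ M : Matrix n n ℂ, (∀ h, M * φ h = φ h * M) → ∃ c : ℂ, M = c • (1 : Matrix n n ℂ)

/-- Two matrix representations are equivalent if they admit an invertible intertwiner. -/
def MatrixRepEquiv (φ : H →* Matrix n n ℂ) (ψ : H →* Matrix m m ℂ) : Prop :=
  ∃ (U : Matrix n m ℂ) (V : Matrix m n ℂ), U * V = 1 ∧ V * U = 1 ∧ ∀ h, φ h * U = U * ψ h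

theorem conjTranspose_map_eq_map_inv {φ : H →* Matrix n n ℂ}
    (hφ : ∀ h, φ h ∈ unitaryGroup n ℂ) (h : H) : (φ h)ᴴ = φ h⁻¹ := by
  have h1 : (φ h)ᴴ * φ h = 1 := mem_unitaryGroup_iff'.1 (hφ h)
  have h2 : φ h * φ h⁻¹ = 1 := by rw [← map_mul, mul_inv_cancel, map_one]
  exact left_inv_eq_right_inv h1 h2

theorem conjTranspose_intertwines {φ : H →* Matrix n n ℂ} {ψ : H →* Matrix m m ℂ}
    (hφ : ∀ h, φ h ∈ unitaryGroup n ℂ) (hψ : ∀ h, ψ h ∈ unitaryGroup m ℂ)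
    {A : Matrix n m ℂ} (hA : ∀ h, φ h * A = A * ψ h) (h : H) : ψ h * Aᴴ = Aᴴ * φ h := by
  have := congrArg conjTranspose (hA h⁻¹)
  rw [conjTranspose_mul, conjTranspose_mul, conjTranspose_map_eq_map_inv hφ,
    conjTranspose_map_eq_map_inv hψ, inv_inv] at this
  exact this.symm

/-- Schur's lemma: intertwiners between inequivalent irreducible representations vanish. -/
theorem intertwiner_eq_zero {φ : H →* Matrix n n ℂ} {ψ : H →* Matrix m m ℂ}
    (hφ : ∀ h, φ h ∈ unitaryGroup n ℂ) (hψ : ∀ h, ψ h ∈ unitaryGroup m ℂ)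
    (iφ : HasScalarCommutant φ) (iψ : HasScalarCommutant ψ) (hne : ¬ MatrixRepEquiv φ ψ)
    {A : Matrix n m ℂ} (hA : ∀ h, φ h * A = A * ψ h) : A = 0 := by
  by_contra h0
  have hA' := conjTranspose_intertwines hφ hψ hA
  obtain ⟨c, hc⟩ := iφ (A * Aᴴ) fun h => by
    rw [Matrix.mul_assoc, ← hA' h, ← Matrix.mul_assoc, ← hA h, Matrix.mul_assoc]
  obtain ⟨c', hc'⟩ := iψ (Aᴴ * A) fun h => by
    rw [Matrix.mul_assoc, ← hA h, ← Matrix.mul_assoc, ← hA' h, Matrix.mul_assoc]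
  have hcc : c = c' := by
    have h1 : (A * Aᴴ) * A = A * (Aᴴ * A) := Matrix.mul_assoc _ _ _
    rw [hc, hc', Matrix.smul_mul, Matrix.mul_smul, Matrix.one_mul, Matrix.mul_one] at h1
    exact smul_left_injective ℂ h0 h1
  have hc0 : c ≠ 0 := by
    rintro rfl
    rw [zero_smul, self_mul_conjTranspose_eq_zero] at hc
    exact h0 hc
  refine hne ⟨A, c⁻¹ • Aᴴ, ?_, ?_, hA⟩
  · rw [Matrix.mul_smul, hc, smul_smul, inv_mul_cancel₀ hc0, one_smul]
  · rw [Matrix.smul_mul, hc', ← hcc, smul_smul, inv_mul_cancel₀ hc0, one_smul]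

theorem average_intertwines [Fintype H] (φ : H →* Matrix n n ℂ) (ψ : H →* Matrix m m ℂ)
    (A : Matrix n m ℂ) (g : H) :
    φ g * ∑ h, φ h * A * ψ h⁻¹ = (∑ h, φ h * A * ψ h⁻¹) * ψ g := by
  rw [Matrix.mul_sum, Matrix.sum_mul, ← Equiv.sum_comp (Equiv.mulLeft g) fun h => _ * ψ g]
  refine Finset.sum_congr rfl fun h _ => ?_
  simp only [Equiv.coe_mulLeft, _root_.mul_inv_rev, map_mul, Matrix.mul_assoc]
  rw [← map_mul ψ g⁻¹ g, inv_mul_cancel, map_one, Matrix.mul_one]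

theorem sum_trace_mul_trace [Fintype H] (φ : H →* Matrix n n ℂ) (ψ : H →* Matrix m m ℂ) :
    ∑ h, (φ h).trace * (ψ h⁻¹).trace =
      ∑ a, ∑ b, (∑ h, φ h * single a b (1 : ℂ) * ψ h⁻¹ : Matrix n m ℂ) a b := by
  simp only [Matrix.sum_apply, trace, Finset.sum_mul_sum, diag_apply]
  rw [Finset.sum_comm]
  refine Finset.sum_congr rfl fun a _ => ?_
  rw [Finset.sum_comm]
  refine Finset.sum_congr rfl fun b _ => Finset.sum_congr rfl fun h _ => ?_
  simp [Matrix.mul_apply, Matrix.single_apply, ite_and]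

theorem sum_trace_mul_trace_eq_zero [Fintype H] {φ : H →* Matrix n n ℂ} {ψ : H →* Matrix m m ℂ}
    (hφ : ∀ h, φ h ∈ unitaryGroup n ℂ) (hψ : ∀ h, ψ h ∈ unitaryGroup m ℂ)
    (iφ : HasScalarCommutant φ) (iψ : HasScalarCommutant ψ) (hne : ¬ MatrixRepEquiv φ ψ) :
    ∑ h, (φ h).trace * (ψ h⁻¹).trace = 0 := by
  rw [sum_trace_mul_trace]
  refine Finset.sum_eq_zero fun a _ => Finset.sum_eq_zero fun b _ => ?_
  rw [intertwiner_eq_zero hφ hψ iφ iψ hne (average_intertwines φ ψ _), Matrix.zero_apply]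

theorem sum_trace_mul_trace_self [Fintype H] [Nonempty n] {φ : H →* Matrix n n ℂ}
    (iφ : HasScalarCommutant φ) :
    ∑ h, (φ h).trace * (φ h⁻¹).trace = Fintype.card H := by
  have hn : (Fintype.card n : ℂ) ≠ 0 := by exact_mod_cast Fintype.card_ne_zero
  have key (a b : n) : (∑ h, φ h * single a b (1 : ℂ) * φ h⁻¹) a b =
      if a = b then (Fintype.card H : ℂ) / Fintype.card n else 0 := by
    obtain ⟨c, hc⟩ := iφ (∑ h, φ h * single a b (1 : ℂ) * φ h⁻¹) fun g =>
      (average_intertwines φ φ _ g).symm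
    have htr := congrArg trace hc
    have hterm (h : H) : (φ h * single a b (1 : ℂ) * φ h⁻¹).trace = if a = b then 1 else 0 := by
      rw [trace_mul_comm, ← Matrix.mul_assoc, ← map_mul, inv_mul_cancel, map_one, Matrix.one_mul]
      split_ifs with hab
      · rw [hab, trace_single_eq_same]
      · exact trace_single_eq_of_ne _ _ _ hab
    rw [trace_sum, Finset.sum_congr rfl fun h _ => hterm h, trace_smul, trace_one] at htr
    rw [hc]
    by_cases hab : a = b
    · simp only [hab, if_true, Finset.sum_const, Finset.card_univ, nsmul_eq_mul, mul_one,
        smul_eq_mul] at htr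
      simp [hab, htr, hn]
    · simp [hab]
  rw [sum_trace_mul_trace]
  simp [key, mul_div_cancel₀, hn]

theorem submatrix_val_mul {k : Type*} [Fintype k] {p : k → Prop} [DecidablePred p]
    {A B : Matrix k k ℂ}
    (hA : ∀ i j, p i → ¬ p j → A i j = 0) :
    (A * B).submatrix (Subtype.val : {i // p i} → k) Subtype.val =
      A.submatrix (Subtype.val : {i // p i} → k) (Subtype.val : {i // p i} → k) *
        B.submatrix Subtype.val Subtype.val := by
  ext i j
  simp only [submatrix_apply, Matrix.mul_apply]
  rw [← Fintype.sum_subtype_add_sum_subtype p, add_eq_left]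
  exact Finset.sum_eq_zero fun l _ => by rw [hA _ _ i.2 l.2, zero_mul]

/-- The block of a matrix representation cut out by an invariant coordinate subspace. -/
def blockRep (φ : H →* Matrix n n ℂ) (p : n → Prop) [DecidablePred p]
    (hp : ∀ h i j, p i → ¬ p j → φ h i j = 0) : H →* Matrix {i // p i} {i // p i} ℂ where
  toFun h := (φ h).submatrix Subtype.val Subtype.val
  map_one' := by rw [map_one, submatrix_one _ Subtype.val_injective]
  map_mul' g h := by rw [map_mul, submatrix_val_mul (hp g)]

theorem blockRep_mem_unitaryGroup {φ : H →* Matrix n n ℂ} (hφ : ∀ h, φ h ∈ unitaryGroup n ℂ)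
    (p : n → Prop) [DecidablePred p] (hp : ∀ h i j, p i → ¬ p j → φ h i j = 0) (h : H) :
    blockRep φ p hp h ∈ unitaryGroup {i // p i} ℂ := by
  have h1 : (blockRep φ p hp h)ᴴ = blockRep φ p hp h⁻¹ := by
    change ((φ h).submatrix _ _)ᴴ = (φ h⁻¹).submatrix _ _
    rw [conjTranspose_submatrix, conjTranspose_map_eq_map_inv hφ]
  rw [mem_unitaryGroup_iff, star_eq_conjTranspose, h1, ← map_mul, mul_inv_cancel, map_one]

/-- Conjugating a matrix representation by a unitary matrix. -/
def conjRep (φ : H →* Matrix n n ℂ) (U : unitaryGroup n ℂ) : H →* Matrix n n ℂ where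
  toFun h := star (U : Matrix n n ℂ) * φ h * U
  map_one' := by simp
  map_mul' g h := by
    have hU : (U : Matrix n n ℂ) * star (U : Matrix n n ℂ) = 1 := mem_unitaryGroup_iff.1 U.2
    rw [map_mul]
    calc _ = star (U : Matrix n n ℂ) * φ g * 1 * φ h * U := by noncomm_ring
      _ = _ := by rw [← hU]; noncomm_ring

theorem conjRep_mem_unitaryGroup {φ : H →* Matrix n n ℂ} (hφ : ∀ h, φ h ∈ unitaryGroup n ℂ)
    (U : unitaryGroup n ℂ) (h : H) : conjRep φ U h ∈ unitaryGroup n ℂ :=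
  mul_mem (mul_mem (star U).2 (hφ h)) U.2

theorem trace_conjRep (φ : H →* Matrix n n ℂ) (U : unitaryGroup n ℂ) (h : H) :
    (conjRep φ U h).trace = (φ h).trace := by
  change (star (U : Matrix n n ℂ) * φ h * U).trace = _
  rw [trace_mul_comm, ← Matrix.mul_assoc, mem_unitaryGroup_iff.1 U.2, Matrix.one_mul]

theorem exists_isHermitian_commuting {φ : H →* Matrix n n ℂ}
    (hφ : ∀ h, φ h ∈ unitaryGroup n ℂ) (iφ : ¬ HasScalarCommutant φ) :
    ∃ A : Matrix n n ℂ, A.IsHermitian ∧ (∀ h, A * φ h = φ h * A) ∧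
      ¬ ∃ c : ℂ, A = c • (1 : Matrix n n ℂ) := by
  by_contra! hcon
  refine iφ fun M hM => ?_
  have hM' := fun h => (conjTranspose_intertwines hφ hφ (fun h => (hM h).symm) h).symm
  obtain ⟨a, ha⟩ := hcon (M + Mᴴ) (isHermitian_add_transpose_self M) fun h => by
    rw [Matrix.add_mul, Matrix.mul_add, hM, hM']
  obtain ⟨b, hb⟩ := hcon (Complex.I • (M - Mᴴ))
    (by
      rw [IsHermitian, conjTranspose_smul, conjTranspose_sub, conjTranspose_conjTranspose,
        Complex.star_def, Complex.conj_I, neg_smul, ← smul_neg, neg_sub]) fun h => by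
    rw [Matrix.smul_mul, Matrix.mul_smul, Matrix.sub_mul, Matrix.mul_sub, hM, hM']
  refine ⟨2⁻¹ * (a - Complex.I * b), ?_⟩
  have : M = (2 : ℂ)⁻¹ • ((M + Mᴴ) - Complex.I • Complex.I • (M - Mᴴ)) := by
    rw [smul_smul, Complex.I_mul_I]
    module
  rw [this, ha, hb]
  module

/-- A reducible unitary representation is unitarily equivalent to a block diagonal one. -/
theorem exists_conjRep_blocks {φ : H →* Matrix n n ℂ}
    (hφ : ∀ h, φ h ∈ unitaryGroup n ℂ) (iφ : ¬ HasScalarCommutant φ) :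
    ∃ (U : unitaryGroup n ℂ) (p : n → Prop), (∃ i, p i) ∧ (∃ i, ¬ p i) ∧
      ∀ h i j, ¬ (p i ↔ p j) → conjRep φ U h i j = 0 := by
  obtain ⟨A, hA, hcomm, hns⟩ := exists_isHermitian_commuting hφ iφ
  set U := hA.eigenvectorUnitary
  set D : Matrix n n ℂ := diagonal ((↑) ∘ hA.eigenvalues) with hD
  have hUU : (U : Matrix n n ℂ) * star (U : Matrix n n ℂ) = 1 := mem_unitaryGroup_iff.1 U.2
  have hUU' : star (U : Matrix n n ℂ) * (U : Matrix n n ℂ) = 1 := mem_unitaryGroup_iff'.1 U.2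
  have hspec : A = U * D * star (U : Matrix n n ℂ) :=
    hA.spectral_theorem.trans (Unitary.conjStarAlgAut_apply _ _)
  have hDc (h : H) : D * conjRep φ U h = conjRep φ U h * D := by
    have hDA : D = star (U : Matrix n n ℂ) * A * U := by
      rw [hspec]
      calc D = 1 * D * 1 := by simp
        _ = _ := by rw [← hUU']; noncomm_ring
    change D * (star (U : Matrix n n ℂ) * φ h * U) = (star (U : Matrix n n ℂ) * φ h * U) * D
    rw [hDA]
    calc _ = star (U : Matrix n n ℂ) * A * (U * star (U : Matrix n n ℂ)) * φ h * U := by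
          noncomm_ring
      _ = star (U : Matrix n n ℂ) * (A * φ h) * U := by rw [hUU]; noncomm_ring
      _ = star (U : Matrix n n ℂ) * φ h * (U * star (U : Matrix n n ℂ)) * A * U := by
          rw [hUU, hcomm]; noncomm_ring
      _ = _ := by noncomm_ring
  have hex : ∃ i j, hA.eigenvalues j ≠ hA.eigenvalues i := by
    by_contra! hcon
    apply hns
    obtain hn | ⟨⟨i⟩⟩ := isEmpty_or_nonempty n
    · exact ⟨0, Matrix.ext fun i => hn.elim i⟩
    · refine ⟨hA.eigenvalues i, ?_⟩
      have : D = (hA.eigenvalues i : ℂ) • (1 : Matrix n n ℂ) := by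
        rw [hD, smul_one_eq_diagonal]
        congr 1
        ext j
        simp [hcon i j]
      calc A = U * D * star (U : Matrix n n ℂ) := hspec
        _ = _ := by rw [this, Matrix.mul_smul, Matrix.smul_mul, Matrix.mul_one, hUU]
  obtain ⟨i₀, j₀, hij⟩ := hex
  refine ⟨U, fun i => hA.eigenvalues i = hA.eigenvalues i₀, ⟨i₀, rfl⟩, ⟨j₀, hij⟩,
    fun h i j hne => ?_⟩
  have := congrFun (congrFun (hDc h) i) j
  rw [hD, diagonal_mul, mul_diagonal, mul_comm, ← sub_eq_zero, ← mul_sub, mul_eq_zero,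
    sub_eq_zero] at this
  refine this.resolve_right fun he => hne ?_
  have he' : hA.eigenvalues i = hA.eigenvalues j := by simpa using he
  simp only [he']

/-- If the irreducible characters of `H` all lie in a subspace `S` of functions on `H`, so do the
characters of all unitary representations. -/
theorem trace_mem_of_irreducible {n : Type u} [Fintype n] [DecidableEq n]
    (S : Submodule ℂ (H → ℂ))
    (hS : ∀ (d : ℕ) (φ : H →* Matrix (Fin d) (Fin d) ℂ), (∀ h, φ h ∈ unitaryGroup (Fin d) ℂ) →
      HasScalarCommutant φ → (fun h => (φ h).trace) ∈ S)
    (φ : H →* Matrix n n ℂ) (hφ : ∀ h, φ h ∈ unitaryGroup n ℂ) :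
    (fun h => (φ h).trace) ∈ S := by
  induction hN : Fintype.card n using Nat.strong_induction_on generalizing n with
  | _ N ih =>
    by_cases iφ : HasScalarCommutant φ
    · let e := Fintype.equivFin n
      let ψ : H →* Matrix (Fin (Fintype.card n)) (Fin (Fintype.card n)) ℂ :=
        (reindexAlgEquiv ℂ ℂ e : Matrix n n ℂ →* _).comp φ
      have hψ (h : H) : ψ h = reindex e e (φ h) := rfl
      have htr (h : H) : (ψ h).trace = (φ h).trace :=
        e.symm.sum_comp fun i => φ h i i
      simp only [← htr]
      refine hS _ ψ (fun h => ?_) fun M hM => ?_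
      · rw [mem_unitaryGroup_iff, hψ, star_eq_conjTranspose, conjTranspose_reindex,
          reindex_apply, reindex_apply, submatrix_mul_equiv, ← star_eq_conjTranspose,
          mem_unitaryGroup_iff.1 (hφ h), submatrix_one_equiv]
      · have hφψ (h : H) : φ h = reindexAlgEquiv ℂ ℂ e.symm (ψ h) :=
          ((reindexAlgEquiv ℂ ℂ e).symm_apply_apply (φ h)).symm
        obtain ⟨c, hc⟩ := iφ (reindexAlgEquiv ℂ ℂ e.symm M) fun h => by
          rw [hφψ, ← map_mul, hM, map_mul]
        refine ⟨c, (reindexAlgEquiv ℂ ℂ e.symm).injective (hc.trans ?_)⟩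
        rw [map_smul, map_one]
    · obtain ⟨U, p, ⟨i₁, hi₁⟩, ⟨i₂, hi₂⟩, hblock⟩ := exists_conjRep_blocks hφ iφ
      have hψ := conjRep_mem_unitaryGroup hφ U
      have hp : ∀ h i j, p i → ¬ p j → conjRep φ U h i j = 0 := fun h i j hi hj =>
        hblock h i j (by tauto)
      have hp' : ∀ h i j, ¬ p i → ¬ ¬ p j → conjRep φ U h i j = 0 := fun h i j hi hj =>
        hblock h i j (by tauto)
      have h₁ := ih _ (hN ▸ Fintype.card_subtype_lt hi₂) (blockRep _ p hp)
        (blockRep_mem_unitaryGroup hψ p hp) rfl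
      have h₂ := ih _ (hN ▸ Fintype.card_subtype_lt (p := fun i => ¬ p i) (not_not.2 hi₁))
        (blockRep _ (fun i => ¬ p i) hp') (blockRep_mem_unitaryGroup hψ _ hp') rfl
      convert S.add_mem h₁ h₂ using 1
      ext h
      rw [← trace_conjRep φ U]
      exact (Fintype.sum_subtype_add_sum_subtype p fun i => conjRep φ U h i i).symm

/-- The regular representation by permutation matrices. -/
def regularMatrixRep (H : Type*) [Group H] [Fintype H] [DecidableEq H] : H →* Matrix H H ℂ where
  toFun h := of fun a b => if a = h * b then 1 else 0
  map_one' := by ext a b; simp [Matrix.one_apply]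
  map_mul' g h := by ext a b; simp [Matrix.mul_apply, mul_assoc]

theorem regularMatrixRep_apply [Fintype H] [DecidableEq H] (h a b : H) :
    regularMatrixRep H h a b = if a = h * b then 1 else 0 := rfl

theorem regularMatrixRep_mem_unitaryGroup [Fintype H] [DecidableEq H] (h : H) :
    regularMatrixRep H h ∈ unitaryGroup H ℂ := by
  have h1 : (regularMatrixRep H h)ᴴ = regularMatrixRep H h⁻¹ := by
    ext a b
    simp only [conjTranspose_apply, regularMatrixRep_apply, eq_inv_mul_iff_mul_eq,
      eq_comm (a := b)]
    split_ifs <;> simp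
  rw [mem_unitaryGroup_iff, star_eq_conjTranspose, h1, ← map_mul, mul_inv_cancel, map_one]

theorem trace_regularMatrixRep [Fintype H] [DecidableEq H] (h : H) :
    (regularMatrixRep H h).trace = if h = 1 then (Fintype.card H : ℂ) else 0 := by
  simp [trace, regularMatrixRep_apply]

/-- Column orthogonality of the character table against the identity. -/
theorem sum_dim_mul_trace [Fintype H] [DecidableEq H] {ι : Type*} [Fintype ι] (d : ι → ℕ)
    (ρ : ∀ i, H →* Matrix (Fin (d i)) (Fin (d i)) ℂ)
    (hρ : ∀ i h, ρ i h ∈ unitaryGroup (Fin (d i)) ℂ) (hirr : ∀ i, HasScalarCommutant (ρ i))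
    (hdistinct : ∀ i j, i ≠ j → ¬ MatrixRepEquiv (ρ i) (ρ j))
    (hcomplete : ∀ (d' : ℕ) (σ : H →* Matrix (Fin d') (Fin d') ℂ),
      (∀ h, σ h ∈ unitaryGroup (Fin d') ℂ) → HasScalarCommutant σ →
        ∃ i, MatrixRepEquiv σ (ρ i)) (h : H) :
    ∑ i, (d i : ℂ) * (ρ i h).trace = if h = 1 then (Fintype.card H : ℂ) else 0 := by
  have hreg := trace_mem_of_irreducible
    (Submodule.span ℂ (Set.range fun i h => (ρ i h).trace))
    (fun d' σ hσ iσ => by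
      obtain ⟨i, U, V, hUV, hVU, hU⟩ := hcomplete d' σ hσ iσ
      refine Submodule.subset_span ⟨i, funext fun h => ?_⟩
      calc (ρ i h).trace = (V * U * ρ i h).trace := by rw [hVU, Matrix.one_mul]
        _ = (V * (σ h * U)).trace := by rw [hU, Matrix.mul_assoc]
        _ = (σ h).trace := by
          rw [trace_mul_comm, Matrix.mul_assoc, hUV, Matrix.mul_one])
    (regularMatrixRep H) regularMatrixRep_mem_unitaryGroup
  obtain ⟨m, hm⟩ := Submodule.mem_span_range_iff_exists_fun ℂ |>.1 hreg
  have hm' (g : H) : ∑ i, m i * (ρ i g).trace = if g = 1 then (Fintype.card H : ℂ) else 0 := by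
    rw [← trace_regularMatrixRep, ← congrFun hm g]
    simp
  rw [← hm' h]
  refine Finset.sum_congr rfl fun j _ => ?_
  obtain hj | hj := Nat.eq_zero_or_pos (d j)
  · have : IsEmpty (Fin (d j)) := by rw [hj]; infer_instance
    simp [trace]
  have : Nonempty (Fin (d j)) := ⟨⟨0, hj⟩⟩
  congr 1
  have hH : (Fintype.card H : ℂ) ≠ 0 := by exact_mod_cast Fintype.card_ne_zero
  apply mul_left_cancel₀ hH
  calc (Fintype.card H : ℂ) * d j
      = ∑ g, (∑ i, m i * (ρ i g).trace) * (ρ j g⁻¹).trace := by simp [hm']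
    _ = ∑ i, m i * ∑ g, (ρ i g).trace * (ρ j g⁻¹).trace := by
      simp_rw [Finset.sum_mul, Finset.mul_sum, mul_assoc]
      exact Finset.sum_comm
    _ = m j * ∑ g, (ρ j g).trace * (ρ j g⁻¹).trace := by
      refine Finset.sum_eq_single j (fun i _ hij => ?_) (by simp)
      rw [sum_trace_mul_trace_eq_zero (hρ i) (hρ j) (hirr i) (hirr j) (hdistinct i j hij),
        mul_zero]
    _ = Fintype.card H * m j := by rw [sum_trace_mul_trace_self (hirr j), mul_comm]

end UnitaryMatrixRep
section Centralizer
variable {G : Type*} [Group G] [Fintype G]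

/-- The representation of the centralizer of `r` encoded by a function on the whole group. -/
def IsCentRep.toMonoidHom {r : G} {d : ℕ} {ρ : G → Matrix (Fin d) (Fin d) ℂ}
    (hρ : IsCentRep r ρ) : Subgroup.centralizer {r} →* Matrix (Fin d) (Fin d) ℂ where
  toFun z := ρ z
  map_one' := hρ.1
  map_mul' z w := hρ.2.1 z w (Subgroup.mem_centralizer_singleton_iff.1 z.2)
    (Subgroup.mem_centralizer_singleton_iff.1 w.2)

theorem IsCentRep.toMonoidHom_apply {r : G} {d : ℕ} {ρ : G → Matrix (Fin d) (Fin d) ℂ}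
    (hρ : IsCentRep r ρ) (z : Subgroup.centralizer {r}) : hρ.toMonoidHom z = ρ z := rfl

theorem repIsoOn_iff {r : G} {d₁ d₂ : ℕ} {ρ₁ : G → Matrix (Fin d₁) (Fin d₁) ℂ}
    {ρ₂ : G → Matrix (Fin d₂) (Fin d₂) ℂ} (h₁ : IsCentRep r ρ₁) (h₂ : IsCentRep r ρ₂) :
    RepIsoOn r ρ₁ ρ₂ ↔ MatrixRepEquiv h₁.toMonoidHom h₂.toMonoidHom := by
  simp only [RepIsoOn, MatrixRepEquiv, Subtype.forall, Subgroup.mem_centralizer_singleton_iff,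
    IsCentRep.toMonoidHom_apply]

theorem hasScalarCommutant_toMonoidHom_iff {r : G} {d : ℕ} {ρ : G → Matrix (Fin d) (Fin d) ℂ}
    (hρ : IsCentRep r ρ) : HasScalarCommutant hρ.toMonoidHom ↔ IsCentIrrep r ρ := by
  simp only [IsCentIrrep, hρ, true_and, HasScalarCommutant, Subtype.forall,
    Subgroup.mem_centralizer_singleton_iff, IsCentRep.toMonoidHom_apply]

/-- Every unitary representation of the centralizer of `r` extends to a function on `G`. -/
theorem exists_isCentRep_toMonoidHom_eq {r : G} {d : ℕ}
    (σ : Subgroup.centralizer {r} →* Matrix (Fin d) (Fin d) ℂ)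
    (hσ : ∀ h, σ h ∈ Matrix.unitaryGroup (Fin d) ℂ) :
    ∃ (ρ : G → Matrix (Fin d) (Fin d) ℂ) (hρ : IsCentRep r ρ), hρ.toMonoidHom = σ := by
  let ρ (g : G) : Matrix (Fin d) (Fin d) ℂ :=
    if hg : g ∈ Subgroup.centralizer {r} then σ ⟨g, hg⟩ else 0
  have hval (z : Subgroup.centralizer {r}) : ρ z = σ z := dif_pos z.2
  have hmem {z : G} (hz : z * r = r * z) : z ∈ Subgroup.centralizer {r} :=
    Subgroup.mem_centralizer_singleton_iff.2 hz
  have hρ : IsCentRep r ρ := by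
    refine ⟨(hval 1).trans σ.map_one, fun z w hz hw => ?_, fun z hz => ?_⟩
    · rw [hval ⟨z, hmem hz⟩, hval ⟨w, hmem hw⟩, ← map_mul]
      exact hval (⟨z, hmem hz⟩ * ⟨w, hmem hw⟩)
    · rw [hval ⟨z, hmem hz⟩]
      exact hσ _
  exact ⟨ρ, hρ, MonoidHom.ext hval⟩

theorem card_conjClass_mul_card_centralizer (r : G) :
    (conjClass r).card * Fintype.card (Subgroup.centralizer {r}) = Fintype.card G := by
  have h := MulAction.card_orbit_mul_card_stabilizer_eq_card_group (ConjAct G) r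
  have hZ := Subgroup.nat_card_centralizer_nat_card_stabilizer r
  rw [Nat.card_eq_fintype_card, Nat.card_eq_fintype_card] at hZ
  have hC : Fintype.card (MulAction.orbit (ConjAct G) r) = (conjClass r).card := by
    rw [← Set.toFinset_card]
    congr 1
    ext c
    simp only [conjClass, Set.mem_toFinset, MulAction.mem_orbit_iff, ConjAct.smul_def,
      Finset.mem_image, Finset.mem_univ, true_and]
    rfl
  rw [hZ, ← hC, h]
  rfl

/-- The weighted sum of the trace operators attached to a single conjugacy class. -/
theorem sum_smul_Mtr {r : G} {p : G → G} {ι : Type*} [Fintype ι] {d : ι → ℕ}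
    {ρ : ∀ i, G → Matrix (Fin (d i)) (Fin (d i)) ℂ}
    (hirr : ∀ i, IsCentIrrep r (ρ i)) (hdistinct : ∀ i j, i ≠ j → ¬ RepIsoOn r (ρ i) (ρ j))
    (hcomplete : ∀ (d' : ℕ) (σ : G → Matrix (Fin d') (Fin d') ℂ),
      IsCentIrrep r σ → ∃ i, RepIsoOn r σ (ρ i)) :
    ∑ i, (((conjClass r).card : ℂ) * (d i : ℂ)) • Mtr r p (ρ i) =
      (Fintype.card G : ℂ) • ∑ c ∈ conjClass r, Fgh (1 : G) c := by
  have hcol (z : G) (hz : z ∈ centFinset r) : ∑ i, (d i : ℂ) * (ρ i z).trace =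
      if z = 1 then (Fintype.card (Subgroup.centralizer {r}) : ℂ) else 0 := by
    have hz' : z ∈ Subgroup.centralizer {r} :=
      Subgroup.mem_centralizer_singleton_iff.2 (Finset.mem_filter.1 hz).2
    have := sum_dim_mul_trace d (fun i => (hirr i).1.toMonoidHom)
      (fun i h => (hirr i).1.2.2 h (Subgroup.mem_centralizer_singleton_iff.1 h.2))
      (fun i => (hasScalarCommutant_toMonoidHom_iff _).2 (hirr i))
      (fun i j hij h => hdistinct i j hij ((repIsoOn_iff _ _).2 h))
      (fun d' σ hσ iσ => by
        obtain ⟨τ, hτ, rfl⟩ := exists_isCentRep_toMonoidHom_eq σ hσ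
        obtain ⟨i, hi⟩ := hcomplete d' τ ((hasScalarCommutant_toMonoidHom_iff hτ).1 iσ)
        exact ⟨i, (repIsoOn_iff _ _).1 hi⟩) ⟨z, hz'⟩
    simpa only [IsCentRep.toMonoidHom_apply, Subgroup.mk_eq_one] using this
  have h1 : (1 : G) ∈ centFinset r := by simp [centFinset]
  calc _ = ∑ c ∈ conjClass r, ∑ z ∈ centFinset r,
        (((conjClass r).card : ℂ) * ∑ i, (d i : ℂ) * (ρ i z).trace) •
          Fgh (p c * z * (p c)⁻¹) c := by
        simp_rw [Mtr, Finset.smul_sum, smul_smul, Finset.mul_sum, Finset.sum_smul, ← mul_assoc]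
        rw [Finset.sum_comm]
        exact Finset.sum_congr rfl fun c _ => Finset.sum_comm
    _ = _ := by
        rw [Finset.smul_sum]
        refine Finset.sum_congr rfl fun c _ => ?_
        rw [Finset.sum_eq_single_of_mem 1 h1 fun z hz hz1 => by
          rw [hcol z hz, if_neg hz1, mul_zero, zero_smul], hcol 1 h1, if_pos rfl, mul_one,
          mul_inv_cancel, ← Nat.cast_mul, card_conjClass_mul_card_centralizer]

/-- A sum over the group splits into sums over conjugacy classes. -/
theorem sum_sum_conjClass {M : Type*} [AddCommMonoid M] {T : Finset G}
    (hT : ∀ g : G, ∃! r, r ∈ T ∧ g ∈ conjClass r) (f : G → M) :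
    ∑ r ∈ T, ∑ c ∈ conjClass r, f c = ∑ g, f g := by
  have hdisj : (T : Set G).PairwiseDisjoint conjClass := fun r hr s hs hrs =>
    Finset.disjoint_left.2 fun g hgr hgs => hrs ((hT g).unique ⟨hr, hgr⟩ ⟨hs, hgs⟩)
  rw [← Finset.sum_biUnion hdisj]
  congr 1
  ext g
  simpa using (hT g).exists

end Centralizer

/-- The weighted sum of all trace anyon-creating operators gives (a multiple of) `Ω`. -/
theorem creating_operators_sum (G : Type*) [Group G] [Fintype G]
    (T : Finset G) (hT : ∀ g : G, ∃! r, r ∈ T ∧ g ∈ conjClass r)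
    (p : G → G → G) (hp : ∀ r ∈ T, ∀ c ∈ conjClass r, p r c * r * (p r c)⁻¹ = c)
    (ι : G → Type) [∀ r, Fintype (ι r)]
    (d : ∀ r, ι r → ℕ)
    (ρ : ∀ r, ∀ i : ι r, G → Matrix (Fin (d r i)) (Fin (d r i)) ℂ)
    (hirr : ∀ r ∈ T, ∀ i : ι r, IsCentIrrep r (ρ r i))
    (hdistinct : ∀ r ∈ T, ∀ i j : ι r, i ≠ j → ¬ RepIsoOn r (ρ r i) (ρ r j))
    (hcomplete : ∀ r ∈ T, ∀ (d' : ℕ) (σ : G → Matrix (Fin d') (Fin d') ℂ),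
      IsCentIrrep r σ → ∃ i : ι r, RepIsoOn r σ (ρ r i)) :
    (∑ r ∈ T, ∑ i : ι r, (((conjClass r).card : ℂ) * ((d r i : ℕ) : ℂ)) • Mtr r (p r) (ρ r i))
        = (Fintype.card G : ℂ) • ∑ g : G, Fgh (1 : G) g ∧
    (Fintype.card G : ℂ)⁻¹ •
        ∑ r ∈ T, ∑ i : ι r,
          ((((conjClass r).card : ℂ) * ((d r i : ℕ) : ℂ)) / (Fintype.card G : ℂ)) •
            Mtr r (p r) (ρ r i)
        = Omega G := by
  have hsum : (∑ r ∈ T, ∑ i : ι r,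
      (((conjClass r).card : ℂ) * ((d r i : ℕ) : ℂ)) • Mtr r (p r) (ρ r i))
        = (Fintype.card G : ℂ) • ∑ g : G, Fgh (1 : G) g := by
    rw [← sum_sum_conjClass hT, Finset.smul_sum]
    exact Finset.sum_congr rfl fun r hr =>
      sum_smul_Mtr (hirr r hr) (hdistinct r hr) (hcomplete r hr)
  refine ⟨hsum, ?_⟩
  have hG : (Fintype.card G : ℂ) ≠ 0 := by exact_mod_cast Fintype.card_ne_zero
  simp_rw [div_eq_inv_mul, ← smul_smul (Fintype.card G : ℂ)⁻¹, ← Finset.smul_sum]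
  rw [hsum, inv_smul_smul₀ hG, Omega]

end
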